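/- Suppose J₁ > J₂ > 0 and N is even. If S is a ground state of H_N on T_N, then there exists a set Λ of sites of T_N whose two coordinates are both even or both odd such that applying the flips φ_r for all r ∈ Λ to S yields the constant configuration S_r ≡ e₁; similarly, if J₂ > J₁ > 0, every ground state is carried by such flips to the constant configuration S_r ≡ e₂. -/

import Mathlib

open scoped BigOperators

/-- The `N × N` torus `(ℤ/Nℤ)²`. -/
abbrev Torus (N : ℕ) := ZMod N × ZMod N

/-- A spin configuration assigns a unit vector of `ℝ²` to each site. -/
def IsConfig {N : ℕ} (S : Torus N → ℝ × ℝ) : Prop :=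
  ∀ r, (S r).1 ^ 2 + (S r).2 ^ 2 = 1

/-- The plaquette-orbital Hamiltonian on the torus. -/
noncomputable def ham (N : ℕ) [NeZero N] (J₁ J₂ : ℝ) (S : Torus N → ℝ × ℝ) : ℝ :=
  - J₁ * ((∑ r : Torus N, if Even r.1.val then (S r).1 * (S (r + (1, 0))).1 else 0)
        + (∑ r : Torus N, if Even r.2.val then (S r).1 * (S (r + (0, 1))).1 else 0))
  - J₂ * ((∑ r : Torus N, if ¬ Even r.1.val then (S r).2 * (S (r + (1, 0))).2 else 0)
        + (∑ r : Torus N, if ¬ Even r.2.val then (S r).2 * (S (r + (0, 1))).2 else 0))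

/-- The plaquette flip `φ_r`. -/
def plaqFlip (N : ℕ) [NeZero N] (r : Torus N) (S : Torus N → ℝ × ℝ) :
    Torus N → ℝ × ℝ := fun u =>
  if u = r ∨ u = r + (1, 0) ∨ u = r + (0, 1) ∨ u = r + (1, 1) then
    if Even r.1.val ∧ Even r.2.val then (-(S u).1, (S u).2)
    else if ¬ Even r.1.val ∧ ¬ Even r.2.val then ((S u).1, -(S u).2)
    else S u
  else S u

/-- Application of the (mutually commuting) flips `φ_r` for all `r ∈ Λ`. -/
noncomputable def plaqFlipSet (N : ℕ) [NeZero N] (Λ : Finset (Torus N))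
    (S : Torus N → ℝ × ℝ) : Torus N → ℝ × ℝ :=
  Λ.toList.foldr (plaqFlip N) S

/-- The sum of `f r * f r'` over the nearest-neighbour edges `{r, r'}` whose lower endpoint has
its coordinate along the edge in `E`. -/
noncomputable def bondSum {N : ℕ} [NeZero N] (E : ZMod N → Prop) [DecidablePred E]
    (f : Torus N → ℝ) : ℝ :=
  (∑ r : Torus N, if E r.1 then f r * f (r + (1, 0)) else 0)
    + (∑ r : Torus N, if E r.2 then f r * f (r + (0, 1)) else 0)

/-- The lower corner along one coordinate of the cell containing `a`, cells starting at the
points of `E`. -/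
def anchor {N : ℕ} (E : ZMod N → Prop) [DecidablePred E] (a : ZMod N) : ZMod N :=
  if E a then a else a - 1

theorem ZMod.even_val_add_one {N : ℕ} [NeZero N] (hN : Even N) (a : ZMod N) :
    Even (a + 1).val ↔ ¬ Even a.val := by
  have h2 : 1 < N := by
    have := NeZero.ne N
    rcases hN with ⟨k, hk⟩
    omega
  have : Fact (1 < N) := ⟨h2⟩
  rw [ZMod.val_add, ZMod.val_one, hN.mod_even_iff, Nat.even_add_one]

section Anchor

variable {N : ℕ} {E : ZMod N → Prop} [DecidablePred E]

theorem anchor_mem (hE : ∀ a, E (a + 1) ↔ ¬ E a) (a : ZMod N) : E (anchor E a) := by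
  unfold anchor
  split_ifs with h
  · exact h
  · have := hE (a - 1)
    rw [sub_add_cancel] at this
    tauto

theorem eq_anchor_or (a : ZMod N) : a = anchor E a ∨ a = anchor E a + 1 := by
  unfold anchor
  split_ifs <;> simp

theorem eq_or_eq_add_one_iff (hE : ∀ a, E (a + 1) ↔ ¬ E a) {a c : ZMod N} (hc : E c) :
    (a = c ∨ a = c + 1) ↔ c = anchor E a := by
  constructor
  · rintro (rfl | rfl)
    · simp [anchor, hc]
    · simp [anchor, hE, hc]
  · rintro rfl
    exact eq_anchor_or a

theorem mem_plaquette_iff (hE : ∀ a, E (a + 1) ↔ ¬ E a) {r : Torus N} (h₁ : E r.1) (h₂ : E r.2)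
    (u : Torus N) :
    (u = r ∨ u = r + (1, 0) ∨ u = r + (0, 1) ∨ u = r + (1, 1)) ↔
      r = (anchor E u.1, anchor E u.2) := by
  have e₁ := eq_or_eq_add_one_iff hE (a := u.1) h₁
  have e₂ := eq_or_eq_add_one_iff hE (a := u.2) h₂
  simp only [Prod.ext_iff, Prod.fst_add, Prod.snd_add, add_zero]
  tauto

theorem eq_apply_anchor (hE : ∀ a, E (a + 1) ↔ ¬ E a) {f : Torus N → ℝ}
    (h₁ : ∀ r : Torus N, E r.1 → f r = f (r + (1, 0)))
    (h₂ : ∀ r : Torus N, E r.2 → f r = f (r + (0, 1))) (u : Torus N) :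
    f u = f (anchor E u.1, anchor E u.2) := by
  obtain ⟨a, b⟩ := u
  have k₁ := h₁ (anchor E a, b) (anchor_mem hE a)
  have k₂ := h₂ (anchor E a, anchor E b) (anchor_mem hE b)
  simp only [Prod.mk_add_mk, add_zero] at k₁ k₂
  have e₁ : f (a, b) = f (anchor E a, b) := by
    rcases eq_anchor_or (E := E) a with h | h
    · rw [← h]
    · rw [k₁, ← h]
  have e₂ : f (anchor E a, b) = f (anchor E a, anchor E b) := by
    rcases eq_anchor_or (E := E) b with h | h
    · rw [← h]
    · rw [k₂, ← h]
  exact e₁.trans e₂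

end Anchor

/-- Folding pairwise disjoint local moves applies to each site the move owning it, if present. -/
theorem foldr_local_apply {α β : Type*} [DecidableEq α] (φ : α → (α → β) → α → β) (b : α → α)
    (σ : β → β) (S : α → β) (l : List α) (hl : l.Nodup)
    (hφ : ∀ r ∈ l, ∀ T u, φ r T u = if r = b u then σ (T u) else T u) (u : α) :
    l.foldr φ S u = if b u ∈ l then σ (S u) else S u := by
  induction l with
  | nil => simp
  | cons r l ih =>
    rw [List.nodup_cons] at hl
    have ih := ih hl.2 fun r hr => hφ r (List.mem_cons_of_mem _ hr)
    rw [List.foldr_cons, hφ r List.mem_cons_self, ih]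
    by_cases h : r = b u
    · subst h
      simp [hl.1]
    · simp [h, Ne.symm h]

theorem sum_alternating_mul {G : Type*} [AddCommGroup G] [Fintype G] (P : G → Prop)
    [DecidablePred P] (e : G) (hP : ∀ r, P (r + e) ↔ ¬ P r) (f : G → ℝ) :
    (∑ r, if P r then f r * f (r + e) else 0) =
      1 / 2 * ∑ r, f r ^ 2 - 1 / 2 * ∑ r, if P r then (f r - f (r + e)) ^ 2 else 0 := by
  have shift : (∑ r, if P r then f (r + e) ^ 2 else 0) = ∑ r, if P r then 0 else f r ^ 2 := by
    rw [← Equiv.sum_comp (Equiv.addRight e) fun r => if P r then 0 else f r ^ 2]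
    exact Finset.sum_congr rfl fun r _ => by by_cases h : P r <;> simp [hP, h]
  have split : ∑ r, f r ^ 2 =
      (∑ r, if P r then f r ^ 2 else 0) + ∑ r, if P r then f (r + e) ^ 2 else 0 := by
    rw [shift, ← Finset.sum_add_distrib]
    exact Finset.sum_congr rfl fun r _ => by by_cases h : P r <;> simp [h]
  rw [split, ← Finset.sum_add_distrib, ← mul_sub, ← Finset.sum_sub_distrib, Finset.mul_sum]
  refine Finset.sum_congr rfl fun r _ => ?_
  split_ifs <;> ring

theorem bondSum_eq {N : ℕ} [NeZero N] {E : ZMod N → Prop} [DecidablePred E]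
    (hE : ∀ a, E (a + 1) ↔ ¬ E a) (f : Torus N → ℝ) :
    bondSum E f = ∑ r, f r ^ 2
      - 1 / 2 * ((∑ r : Torus N, if E r.1 then (f r - f (r + (1, 0))) ^ 2 else 0)
        + ∑ r : Torus N, if E r.2 then (f r - f (r + (0, 1))) ^ 2 else 0) := by
  unfold bondSum
  rw [sum_alternating_mul (fun r : Torus N => E r.1) (1, 0) (fun r => hE r.1) f,
    sum_alternating_mul (fun r : Torus N => E r.2) (0, 1) (fun r => hE r.2) f]
  ring

theorem sum_ite_sq_nonneg {α : Type*} [Fintype α] (P : α → Prop) [DecidablePred P] (f : α → ℝ) :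
    0 ≤ ∑ r, if P r then f r ^ 2 else 0 :=
  Finset.sum_nonneg fun r _ => by split_ifs <;> positivity

theorem eq_zero_of_sum_ite_sq_eq_zero {α : Type*} [Fintype α] {P : α → Prop} [DecidablePred P]
    {f : α → ℝ} (h : (∑ r, if P r then f r ^ 2 else 0) = 0) (r : α) (hr : P r) : f r = 0 := by
  rw [Finset.sum_eq_zero_iff_of_nonneg fun r _ => by split_ifs <;> positivity] at h
  simpa [hr] using h r (Finset.mem_univ r)

/-- A configuration whose energy is at most that of the constant configuration along the strongly
coupled component has zero weak component, and its strong component is constant on plaquettes. -/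
theorem rigidity_of_energy_le {N : ℕ} [NeZero N] {E F : ZMod N → Prop} [DecidablePred E]
    [DecidablePred F] (hE : ∀ a, E (a + 1) ↔ ¬ E a) (hF : ∀ a, F (a + 1) ↔ ¬ F a) {J K : ℝ}
    (hKJ : K < J) (hK : 0 < K) {f g : Torus N → ℝ} (hfg : ∀ r, f r ^ 2 + g r ^ 2 = 1)
    (h : -J * bondSum E f - K * bondSum F g ≤
      -J * bondSum E (fun _ => 1) - K * bondSum F (fun _ => 0)) :
    (∀ r, g r = 0) ∧ ∀ u, f u = f (anchor E u.1, anchor E u.2) := by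
  have hsum : ∑ r, f r ^ 2 + ∑ r, g r ^ 2 = ∑ _r : Torus N, (1 : ℝ) ^ 2 := by
    rw [← Finset.sum_add_distrib]
    exact Finset.sum_congr rfl fun r _ => by rw [hfg, one_pow]
  simp only [bondSum_eq hE, bondSum_eq hF, ← hsum, sub_self, ne_eq, OfNat.ofNat_ne_zero,
    not_false_eq_true, zero_pow, ite_self, Finset.sum_const_zero, add_zero, mul_zero, sub_zero]
    at h
  have a₁ := sum_ite_sq_nonneg (fun r : Torus N => E r.1) fun r => f r - f (r + (1, 0))
  have a₂ := sum_ite_sq_nonneg (fun r : Torus N => E r.2) fun r => f r - f (r + (0, 1))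
  have b₁ := sum_ite_sq_nonneg (fun r : Torus N => F r.1) fun r => g r - g (r + (1, 0))
  have b₂ := sum_ite_sq_nonneg (fun r : Torus N => F r.2) fun r => g r - g (r + (0, 1))
  have hg : 0 ≤ ∑ r, g r ^ 2 := Finset.sum_nonneg fun r _ => sq_nonneg _
  have p₁ := mul_nonneg (hK.trans hKJ).le a₁
  have p₂ := mul_nonneg (hK.trans hKJ).le a₂
  have q₁ := mul_nonneg hK.le b₁
  have q₂ := mul_nonneg hK.le b₂
  have pg := mul_nonneg (sub_pos.2 hKJ).le hg
  have hJ : J ≠ 0 := (hK.trans hKJ).ne'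
  have zg := (mul_eq_zero.1 (le_antisymm (by linarith) pg)).resolve_left (sub_pos.2 hKJ).ne'
  have z₁ := (mul_eq_zero.1 (le_antisymm (by linarith) p₁)).resolve_left hJ
  have z₂ := (mul_eq_zero.1 (le_antisymm (by linarith) p₂)).resolve_left hJ
  refine ⟨fun r => ?_, eq_apply_anchor hE
    (fun r hr => sub_eq_zero.1 (eq_zero_of_sum_ite_sq_eq_zero z₁ r hr))
    fun r hr => sub_eq_zero.1 (eq_zero_of_sum_ite_sq_eq_zero z₂ r hr)⟩
  rw [Finset.sum_eq_zero_iff_of_nonneg fun r _ => sq_nonneg _] at zg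
  exact pow_eq_zero_iff two_ne_zero |>.1 (zg r (Finset.mem_univ r))

theorem ham_eq_bondSum {N : ℕ} [NeZero N] (J₁ J₂ : ℝ) (S : Torus N → ℝ × ℝ) :
    ham N J₁ J₂ S = -J₁ * bondSum (fun a => Even a.val) (fun r => (S r).1)
      - J₂ * bondSum (fun a => ¬ Even a.val) (fun r => (S r).2) := rfl

/-- Flipping the plaquettes anchored in `E` at which the spin differs from `v` yields `v`. -/
theorem exists_plaqFlipSet_eq {N : ℕ} [NeZero N] {E : ZMod N → Prop} [DecidablePred E]
    (hE : ∀ a, E (a + 1) ↔ ¬ E a) {S : Torus N → ℝ × ℝ} {σ : ℝ × ℝ → ℝ × ℝ} {v : ℝ × ℝ}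
    (hflip : ∀ r : Torus N, E r.1 → E r.2 → ∀ T u, plaqFlip N r T u =
      if u = r ∨ u = r + (1, 0) ∨ u = r + (0, 1) ∨ u = r + (1, 1) then σ (T u) else T u)
    (hv : ∀ u, S u = v ∨ σ (S u) = v)
    (hS : ∀ u, S u = S (anchor E u.1, anchor E u.2)) :
    ∃ Λ : Finset (Torus N), (∀ r ∈ Λ, E r.1 ∧ E r.2) ∧ ∀ u, plaqFlipSet N Λ S u = v := by
  classical
  refine ⟨Finset.univ.filter fun r => (E r.1 ∧ E r.2) ∧ S r ≠ v,
    fun r hr => (Finset.mem_filter.1 hr).2.1, fun u => ?_⟩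
  unfold plaqFlipSet
  rw [foldr_local_apply (plaqFlip N) (fun u => (anchor E u.1, anchor E u.2)) σ S _
    (Finset.nodup_toList _)]
  · simp only [Finset.mem_toList, Finset.mem_filter, Finset.mem_univ, true_and, anchor_mem hE]
    rw [← hS u]
    split_ifs with h
    · exact (hv u).resolve_left h
    · exact not_not.1 h
  · intro r hr T u
    simp only [Finset.mem_toList, Finset.mem_filter, Finset.mem_univ, true_and] at hr
    rw [hflip r hr.1.1 hr.1.2]
    simp only [mem_plaquette_iff hE hr.1.1 hr.1.2]

/-- Away from the symmetric point, every ground state is carried by plaquette flips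
on a set of equal-parity sites to the constant configuration `e₁` (if `J₁ > J₂ > 0`),
resp. `e₂` (if `J₂ > J₁ > 0`). -/
theorem ground_state_structure_asymmetric (N : ℕ) [NeZero N] (hN : Even N) (J₁ J₂ : ℝ)
    (S : Torus N → ℝ × ℝ) (hS : IsConfig S)
    (hground : ∀ S' : Torus N → ℝ × ℝ, IsConfig S' → ham N J₁ J₂ S ≤ ham N J₁ J₂ S') :
    (J₂ < J₁ → 0 < J₂ →
      ∃ Λ : Finset (Torus N),
        (∀ r ∈ Λ, (Even r.1.val ∧ Even r.2.val) ∨ (¬ Even r.1.val ∧ ¬ Even r.2.val)) ∧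
        ∀ u : Torus N, plaqFlipSet N Λ S u = ((1 : ℝ), (0 : ℝ))) ∧
    (J₁ < J₂ → 0 < J₁ →
      ∃ Λ : Finset (Torus N),
        (∀ r ∈ Λ, (Even r.1.val ∧ Even r.2.val) ∨ (¬ Even r.1.val ∧ ¬ Even r.2.val)) ∧
        ∀ u : Torus N, plaqFlipSet N Λ S u = ((0 : ℝ), (1 : ℝ))) := by
  have hE := ZMod.even_val_add_one hN
  have hO (a : ZMod N) : ¬ Even (a + 1).val ↔ ¬ ¬ Even a.val := not_congr (hE a)
  constructor
  · intro hJ hpos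
    have h := hground (fun _ => (1, 0)) fun _ => by norm_num
    rw [ham_eq_bondSum, ham_eq_bondSum] at h
    obtain ⟨hz, hx⟩ := rigidity_of_energy_le hE hO hJ hpos hS h
    obtain ⟨Λ, hΛ, h⟩ := exists_plaqFlipSet_eq (E := fun a : ZMod N => Even a.val) hE
      (S := S) (σ := fun s => (-s.1, s.2)) (v := (1, 0))
      (fun r h₁ h₂ T u => by simp [plaqFlip, h₁, h₂])
      (fun u => by
        have h1 : (S u).1 ^ 2 = 1 := by simpa [hz u] using hS u
        rcases eq_or_eq_neg_of_sq_eq_sq _ 1 (h1.trans (one_pow 2).symm) with h | h <;>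
          simp [Prod.ext_iff, hz u, h])
      (fun u => Prod.ext (hx u) (by rw [hz, hz]))
    exact ⟨Λ, fun r hr => Or.inl (hΛ r hr), h⟩
  · intro hJ hpos
    have h := hground (fun _ => (0, 1)) fun _ => by norm_num
    rw [ham_eq_bondSum, ham_eq_bondSum] at h
    obtain ⟨hx, hz⟩ := rigidity_of_energy_le hO hE hJ hpos
      (fun r => (add_comm _ _).trans (hS r)) (by linarith)
    obtain ⟨Λ, hΛ, h⟩ := exists_plaqFlipSet_eq (E := fun a : ZMod N => ¬ Even a.val) hO
      (S := S) (σ := fun s => (s.1, -s.2)) (v := (0, 1))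
      (fun r h₁ h₂ T u => by simp only [plaqFlip, h₁, h₂]; simp)
      (fun u => by
        have h1 : (S u).2 ^ 2 = 1 := by simpa [hx u] using hS u
        rcases eq_or_eq_neg_of_sq_eq_sq _ 1 (h1.trans (one_pow 2).symm) with h | h <;>
          simp [Prod.ext_iff, hx u, h])
      (fun u => Prod.ext (by rw [hx, hx]) (hz u))
    exact ⟨Λ, fun r hr => Or.inr (hΛ r hr), h⟩
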